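/- Assume (H3) and ∫₀¹ f(t) dt ≥ 0. Define, in the extended real numbers, c_F = sup{c ∈ ℝ : the BVP on [0, s_*] admits a positive solution} and c_B = inf{c ∈ ℝ : the BVP on [s_*, 1] admits a positive solution}, with the conventions sup ∅ = −∞ and inf ∅ = +∞. Then there exists c ∈ ℝ for which the boundary value problem on [0, 1] admits a positive solution if and only if c_F < c_B; moreover, in that case such c is unique, satisfies c_F < c < c_B, and the corresponding positive solution on [0,1] is unique. -/

import Mathlib

open MeasureTheory Set Filter Topology intervalIntegral

noncomputable section

/-- A Carathéodory solution on `[a,b]` of the ODE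
`y'(t) = p' * ((c - h t) * (y⁺ t)^(1/p) - f t)`, in integral form. -/
def IsCaraSol (p p' : ℝ) (h f : ℝ → ℝ) (c a b : ℝ) (y : ℝ → ℝ) : Prop :=
  ContinuousOn y (Set.Icc a b) ∧
  ∀ t ∈ Set.Icc a b,
    y t = y a + ∫ u in a..t, p' * ((c - h u) * (max (y u) 0) ^ (1 / p) - f u)

/-- A positive solution of the boundary value problem on `[a,b]`. -/
def IsPosBVPSol (p p' : ℝ) (h f : ℝ → ℝ) (c a b : ℝ) (y : ℝ → ℝ) : Prop :=
  IsCaraSol p p' h f c a b y ∧ y a = 0 ∧ y b = 0 ∧ ∀ t ∈ Set.Ioo a b, 0 < y t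

theorem intervalIntegrable_caraRhs {p p' M c a b : ℝ} {h f w : ℝ → ℝ} (hp : 0 < p) (hab : a ≤ b)
    (hmeas : Measurable h) (hbd : ∀ t ∈ Icc a b, |h t| ≤ M)
    (hf : IntervalIntegrable f volume a b) (hw : ContinuousOn w (Icc a b)) :
    IntervalIntegrable (fun u => p' * ((c - h u) * (max (w u) 0) ^ (1 / p) - f u)) volume a b := by
  have hh : IntervalIntegrable h volume a b := by
    rw [intervalIntegrable_iff_integrableOn_Icc_of_le hab]
    refine Measure.integrableOn_of_bounded (M := M) (by simp) hmeas.aestronglyMeasurable ?_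
    filter_upwards [ae_restrict_mem measurableSet_Icc] with t ht
    exact hbd t ht
  refine IntervalIntegrable.const_mul (IntervalIntegrable.sub
    (IntervalIntegrable.mul_continuousOn (intervalIntegrable_const.sub hh) ?_) hf) _
  rw [uIcc_of_le hab]
  exact ContinuousOn.rpow_const (hw.sup continuousOn_const) (fun _ _ => Or.inr (by positivity))

theorem IsCaraSol.sub_eq_integral {p p' M c a b : ℝ} {h f y : ℝ → ℝ} (hp : 0 < p)
    (hmeas : Measurable h) (hbd : ∀ t ∈ Icc a b, |h t| ≤ M)
    (hf : IntervalIntegrable f volume a b) (hy : IsCaraSol p p' h f c a b y)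
    {r t : ℝ} (hr : r ∈ Icc a b) (ht : t ∈ Icc a b) :
    y t - y r = ∫ u in r..t, p' * ((c - h u) * (max (y u) 0) ^ (1 / p) - f u) := by
  have hab : a ≤ b := hr.1.trans hr.2
  have hi := intervalIntegrable_caraRhs (p' := p') (c := c) hp hab hmeas hbd hf hy.1
  rw [hy.2 t ht, hy.2 r hr, add_sub_add_left_eq_sub]
  refine integral_interval_sub_left (hi.mono_set ?_) (hi.mono_set ?_)
  · rw [uIcc_of_le hab, uIcc_of_le ht.1]; exact Icc_subset_Icc_right ht.2
  · rw [uIcc_of_le hab, uIcc_of_le hr.1]; exact Icc_subset_Icc_right hr.2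

theorem IsCaraSol.mono {p p' M c a b a' b' : ℝ} {h f y : ℝ → ℝ} (hp : 0 < p)
    (hmeas : Measurable h) (hbd : ∀ t ∈ Icc a b, |h t| ≤ M)
    (hf : IntervalIntegrable f volume a b) (hy : IsCaraSol p p' h f c a b y)
    (ha : a ≤ a') (hb : b' ≤ b) : IsCaraSol p p' h f c a' b' y := by
  refine ⟨hy.1.mono (Icc_subset_Icc ha hb), fun t ht => ?_⟩
  rw [← hy.sub_eq_integral hp hmeas hbd hf (r := a') (t := t)]
  · ring
  · exact ⟨ha, (ht.1.trans ht.2).trans hb⟩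
  · exact ⟨ha.trans ht.1, ht.2.trans hb⟩

theorem IsCaraSol.congr {p p' c a b : ℝ} {h f y z : ℝ → ℝ}
    (hy : IsCaraSol p p' h f c a b y) (hyz : EqOn y z (Icc a b)) :
    IsCaraSol p p' h f c a b z := by
  refine ⟨hy.1.congr hyz.symm, fun t ht => ?_⟩
  have hab : a ≤ b := ht.1.trans ht.2
  rw [← hyz ht, ← hyz (left_mem_Icc.2 hab), hy.2 t ht]
  congr 1
  refine integral_congr fun u hu => ?_
  rw [uIcc_of_le ht.1] at hu
  simp only [hyz (Icc_subset_Icc_right ht.2 hu)]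

theorem IsCaraSol.glue {p p' M c a b d : ℝ} {h f y : ℝ → ℝ} (hp : 0 < p)
    (hab : a ≤ b) (hbc : b ≤ d)
    (hmeas : Measurable h) (hbd : ∀ t ∈ Icc a d, |h t| ≤ M)
    (hf : IntervalIntegrable f volume a d)
    (h₁ : IsCaraSol p p' h f c a b y) (h₂ : IsCaraSol p p' h f c b d y) :
    IsCaraSol p p' h f c a d y := by
  have hcont : ContinuousOn y (Icc a d) := by
    rw [← Icc_union_Icc_eq_Icc hab hbc]
    exact h₁.1.union_of_isClosed h₂.1 isClosed_Icc isClosed_Icc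
  refine ⟨hcont, fun t ht => ?_⟩
  rcases le_total t b with htb | hbt
  · exact h₁.2 t ⟨ht.1, htb⟩
  · have hi := intervalIntegrable_caraRhs (p' := p') (c := c) hp (hab.trans hbc) hmeas hbd hf hcont
    rw [h₂.2 t ⟨hbt, ht.2⟩, h₁.2 b ⟨hab, le_rfl⟩, add_assoc, integral_add_adjacent_intervals]
    · refine hi.mono_set ?_
      rw [uIcc_of_le (hab.trans hbc), uIcc_of_le hab]; exact Icc_subset_Icc_right hbc
    · refine hi.mono_set ?_
      rw [uIcc_of_le (hab.trans hbc), uIcc_of_le hbt]; exact Icc_subset_Icc hab ht.2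

theorem IsCaraSol.reflect {p p' M c a b : ℝ} {h f y : ℝ → ℝ} (hp : 0 < p)
    (hmeas : Measurable h) (hbd : ∀ t ∈ Icc a b, |h t| ≤ M)
    (hf : IntervalIntegrable f volume a b) (hy : IsCaraSol p p' h f c a b y) :
    IsCaraSol p p' (fun t => -h (1 - t)) (fun t => -f (1 - t)) (-c) (1 - b) (1 - a)
      (fun t => y (1 - t)) := by
  have hmaps : ∀ t ∈ Icc (1 - b) (1 - a), 1 - t ∈ Icc a b := fun t ht =>
    ⟨by linarith [ht.2], by linarith [ht.1]⟩
  refine ⟨hy.1.comp (by fun_prop) hmaps, fun t ht => ?_⟩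
  have hab : a ≤ b := by linarith [ht.1, ht.2]
  have key := hy.sub_eq_integral hp hmeas hbd hf (r := b) (t := 1 - t) ⟨hab, le_rfl⟩ (hmaps t ht)
  have hsub := integral_comp_sub_left (a := 1 - b) (b := t)
    (fun u => p' * ((c - h u) * (max (y u) 0) ^ (1 / p) - f u)) 1
  rw [sub_sub_cancel, integral_symm b (1 - t), ← key] at hsub
  have hneg : ∫ u in (1 - b)..t, p' * ((-c - -h (1 - u)) * (max (y (1 - u)) 0) ^ (1 / p)
      - -f (1 - u)) = - ∫ u in (1 - b)..t,
        p' * ((c - h (1 - u)) * (max (y (1 - u)) 0) ^ (1 / p) - f (1 - u)) := by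
    rw [← intervalIntegral.integral_neg]
    exact integral_congr fun u _ => by ring
  beta_reduce
  rw [hneg, hsub, sub_sub_cancel]
  ring

theorem AbsolutelyContinuousOnInterval.lipschitzOnWith_comp {f φ : ℝ → ℝ} {a b : ℝ} {K : NNReal}
    {T : Set ℝ} (hf : AbsolutelyContinuousOnInterval f a b) (hφ : LipschitzOnWith K φ T)
    (hT : MapsTo f (uIcc a b) T) : AbsolutelyContinuousOnInterval (fun x => φ (f x)) a b := by
  rw [absolutelyContinuousOnInterval_iff] at hf ⊢
  intro ε hε
  obtain ⟨δ, hδ, H⟩ := hf (ε / (K + 1)) (by positivity)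
  refine ⟨δ, hδ, fun E hE hEδ => ?_⟩
  calc ∑ i ∈ Finset.range E.1, dist (φ (f (E.2 i).1)) (φ (f (E.2 i).2))
      ≤ ∑ i ∈ Finset.range E.1, K * dist (f (E.2 i).1) (f (E.2 i).2) := by
        refine Finset.sum_le_sum fun i hi => ?_
        exact hφ.dist_le_mul _ (hT (hE.1 i hi).1) _ (hT (hE.1 i hi).2)
    _ = K * ∑ i ∈ Finset.range E.1, dist (f (E.2 i).1) (f (E.2 i).2) :=
        (Finset.mul_sum _ _ _).symm
    _ ≤ K * (ε / (K + 1)) := by gcongr; exact (H E hE hEδ).le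
    _ < (K + 1) * (ε / (K + 1)) := by gcongr; linarith
    _ = ε := by field

/-- Chain rule for powers of a positive primitive of an integrable function. -/
theorem rpow_sub_rpow_eq_integral {y g : ℝ → ℝ} {a b q : ℝ} (hab : a ≤ b)
    (hg : IntervalIntegrable g volume a b) (hy : ∀ t ∈ Icc a b, y t = y a + ∫ u in a..t, g u)
    (hpos : ∀ t ∈ Icc a b, 0 < y t) :
    IntervalIntegrable (fun u => q * y u ^ (q - 1) * g u) volume a b ∧
    y b ^ q - y a ^ q = ∫ u in a..b, q * y u ^ (q - 1) * g u := by
  set Y : ℝ → ℝ := fun t => y a + ∫ u in a..t, g u with hY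
  have hYy : ∀ t ∈ Icc a b, Y t = y t := fun t ht => (hy t ht).symm
  have hYac : AbsolutelyContinuousOnInterval Y a b :=
    (contDiffOn_const (c := y a)).absolutelyContinuousOnInterval.fun_add
      (hg.absolutelyContinuousOnInterval_intervalIntegral left_mem_uIcc)
  have hYc : ContinuousOn Y (Icc a b) := by simpa [uIcc_of_le hab] using hYac.continuousOn
  obtain ⟨x₀, hx₀, hmin⟩ := isCompact_Icc.exists_isMinOn (nonempty_Icc.2 hab) hYc
  obtain ⟨x₁, hx₁, hmax⟩ := isCompact_Icc.exists_isMaxOn (nonempty_Icc.2 hab) hYc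
  have hm : 0 < Y x₀ := by rw [hYy _ hx₀]; exact hpos _ hx₀
  have hC : ContDiffOn ℝ 1 (fun x : ℝ => x ^ q) (Icc (Y x₀) (Y x₁)) := fun x hx =>
    (Real.contDiffAt_rpow_const_of_ne (hm.trans_le hx.1).ne').contDiffWithinAt
  obtain ⟨K, hK⟩ := hC.exists_lipschitzOnWith one_ne_zero (convex_Icc _ _) isCompact_Icc
  have hZ : AbsolutelyContinuousOnInterval (fun t => Y t ^ q) a b := by
    have hT : MapsTo Y (uIcc a b) (Icc (Y x₀) (Y x₁)) := by
      intro t ht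
      rw [uIcc_of_le hab] at ht
      exact ⟨isMinOn_iff.1 hmin t ht, isMaxOn_iff.1 hmax t ht⟩
    exact AbsolutelyContinuousOnInterval.lipschitzOnWith_comp (φ := fun x => x ^ q) hYac hK hT
  refine ⟨?_, ?_⟩
  · refine hg.continuousOn_mul ?_
    rw [uIcc_of_le hab]
    refine continuousOn_const.mul (ContinuousOn.rpow_const (hYc.congr fun t ht => (hYy t ht).symm) ?_)
    exact fun t ht => Or.inl (hpos t ht).ne'
  · rw [← hYy b (right_mem_Icc.2 hab), ← hYy a (left_mem_Icc.2 hab), ← hZ.integral_deriv_eq_sub]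
    refine integral_congr_ae ?_
    filter_upwards [hg.ae_hasDerivAt_integral] with t ht htm
    have htm' : t ∈ Icc a b := by
      rw [uIoc_of_le hab] at htm; exact ⟨htm.1.le, htm.2⟩
    have hd : HasDerivAt Y (g t) t :=
      (ht (uIoc_subset_uIcc htm) a left_mem_uIcc).const_add (y a)
    have hYt : Y t ≠ 0 := by rw [hYy t htm']; exact (hpos t htm').ne'
    rw [(hd.rpow_const (p := q) (Or.inl hYt)).deriv, hYy t htm']
    ring

/-- Standing assumptions on an interval `[0, s]` on which the reaction term is negative. -/
structure NegReaction (p p' s M : ℝ) (h f : ℝ → ℝ) : Prop where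
  one_lt : 1 < p
  conj : p' = p / (p - 1)
  pos : 0 < s
  meas : Measurable h
  bdd : ∀ t ∈ Icc 0 s, |h t| ≤ M
  integrable : IntervalIntegrable f volume 0 s
  neg : ∀ t ∈ Ioo 0 s, f t < 0
  usc : UpperSemicontinuousOn f (Ioo 0 s)

namespace NegReaction

variable {p p' s M : ℝ} {h f : ℝ → ℝ}

theorem p_pos (H : NegReaction p p' s M h f) : 0 < p := by linarith [H.one_lt]

theorem p'_pos (H : NegReaction p p' s M h f) : 0 < p' := by
  rw [H.conj]; exact div_pos H.p_pos (by linarith [H.one_lt])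

theorem exponent_pos (H : NegReaction p p' s M h f) : 0 < 1 - 1 / p := by
  have := H.one_lt
  rw [sub_pos, div_lt_one H.p_pos]; exact this

theorem exponent_mul (H : NegReaction p p' s M h f) : (1 - 1 / p) * p' = 1 := by
  have h1 := H.one_lt
  have h2 : p - 1 ≠ 0 := by linarith
  have h3 := H.p_pos.ne'
  rw [H.conj]; field_simp

theorem M_nonneg (H : NegReaction p p' s M h f) : 0 ≤ M :=
  (abs_nonneg _).trans (H.bdd 0 ⟨le_rfl, H.pos.le⟩)

theorem rhs_integrable (H : NegReaction p p' s M h f) {c r t : ℝ} {w : ℝ → ℝ}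
    (hw : ContinuousOn w (Icc 0 s)) (hr : r ∈ Icc 0 s) (ht : t ∈ Icc 0 s) :
    IntervalIntegrable (fun u => p' * ((c - h u) * (max (w u) 0) ^ (1 / p) - f u)) volume r t := by
  refine (intervalIntegrable_caraRhs H.p_pos H.pos.le H.meas H.bdd H.integrable hw).mono_set ?_
  rw [uIcc_of_le H.pos.le]
  exact uIcc_subset_Icc hr ht

theorem sub_eq (H : NegReaction p p' s M h f) {c r t : ℝ} {y : ℝ → ℝ}
    (hy : IsCaraSol p p' h f c 0 s y) (hr : r ∈ Icc 0 s) (ht : t ∈ Icc 0 s) :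
    y t - y r = ∫ u in r..t, p' * ((c - h u) * (max (y u) 0) ^ (1 / p) - f u) :=
  hy.sub_eq_integral H.p_pos H.meas H.bdd H.integrable hr ht

theorem nonneg_of_mem_Ioo (H : NegReaction p p' s M h f) {c : ℝ} {y : ℝ → ℝ}
    (hy : IsCaraSol p p' h f c 0 s y) (hy0 : y 0 = 0) {t : ℝ} (ht : t ∈ Ioo 0 s) : 0 ≤ y t := by
  by_contra! hneg
  have hsub : Icc 0 t ⊆ Icc 0 s := Icc_subset_Icc_right ht.2.le
  have hcl : IsClosed (Icc 0 t ∩ y ⁻¹' Ici 0) :=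
    (hy.1.mono hsub).preimage_isClosed_of_isClosed isClosed_Icc isClosed_Ici
  have hcpt : IsCompact (Icc 0 t ∩ y ⁻¹' Ici 0) :=
    isCompact_Icc.of_isClosed_subset hcl inter_subset_left
  obtain ⟨a, ⟨haI, hay⟩, hamax⟩ := hcpt.exists_isGreatest ⟨0, ⟨le_rfl, ht.1.le⟩, hy0.ge⟩
  have hint := H.sub_eq hy (hsub haI) (Ioo_subset_Icc_self ht)
  have hnn : 0 ≤ ∫ u in a..t, p' * ((c - h u) * (max (y u) 0) ^ (1 / p) - f u) := by
    refine integral_nonneg_of_ae_restrict haI.2 ?_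
    have hne : ∀ᵐ u ∂(volume.restrict (Icc a t)), u ≠ a :=
      ae_restrict_of_ae (by simp [ae_iff])
    filter_upwards [ae_restrict_mem measurableSet_Icc, hne] with u hu hua
    have hau : a < u := lt_of_le_of_ne hu.1 (Ne.symm hua)
    have hyu : y u < 0 := by
      by_contra! hyu
      exact absurd (hamax ⟨⟨haI.1.trans hu.1, hu.2⟩, hyu⟩) (not_le.2 hau)
    have hf := H.neg u ⟨haI.1.trans_lt hau, hu.2.trans_lt ht.2⟩
    have hp0 : (1 / p) ≠ 0 := (one_div_pos.2 H.p_pos).ne'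
    simp only [Pi.zero_apply, max_eq_right hyu.le, Real.zero_rpow hp0, mul_zero, zero_sub]
    exact mul_nonneg H.p'_pos.le (by linarith)
  have : 0 ≤ y a := hay
  linarith

theorem pos_of_mem_Ioo (H : NegReaction p p' s M h f) {c : ℝ} {y : ℝ → ℝ}
    (hy : IsCaraSol p p' h f c 0 s y) (hy0 : y 0 = 0) {t : ℝ} (ht : t ∈ Ioo 0 s) : 0 < y t := by
  refine lt_of_le_of_ne (H.nonneg_of_mem_Ioo hy hy0 ht) fun hyt => ?_
  have hft := H.neg t ht
  have hcont : ContinuousAt y t := hy.1.continuousAt (Icc_mem_nhds ht.1 ht.2)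
  have hp0 : 0 < 1 / p := one_div_pos.2 H.p_pos
  have hlim : Tendsto (fun u => (|c| + M) * (max (y u) 0) ^ (1 / p)) (𝓝 t) (𝓝 0) := by
    have h1 : ContinuousAt (fun u => (|c| + M) * (max (y u) 0) ^ (1 / p)) t :=
      continuousAt_const.mul ((hcont.sup continuousAt_const).rpow_const (Or.inr hp0.le))
    have h2 := h1.tendsto
    simpa [← hyt, Real.zero_rpow hp0.ne', H.p_pos.ne'] using h2
  have e1 : ∀ᶠ u in 𝓝 t, (|c| + M) * (max (y u) 0) ^ (1 / p) < -(f t) / 2 :=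
    hlim.eventually_lt_const (by linarith)
  have e2 : ∀ᶠ u in 𝓝 t, f u < f t / 2 := by
    have := H.usc t ht (f t / 2) (by linarith)
    rwa [nhdsWithin_eq_nhds.2 (Ioo_mem_nhds ht.1 ht.2)] at this
  obtain ⟨l, hl, hlt⟩ := mem_nhdsLE_iff_exists_Icc_subset.1 (nhdsWithin_le_nhds
    (s := Iic t) (e1.and (e2.and (Ioo_mem_nhds ht.1 ht.2))))
  have hlt' : l < t := hl
  have hlm := (hlt ⟨le_rfl, hlt'.le⟩).2.2
  have hint := H.sub_eq hy (Ioo_subset_Icc_self hlm) (Ioo_subset_Icc_self ht)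
  have hpos : 0 < ∫ u in l..t, p' * ((c - h u) * (max (y u) 0) ^ (1 / p) - f u) := by
    refine intervalIntegral_pos_of_pos_on (H.rhs_integrable hy.1 (Ioo_subset_Icc_self hlm)
      (Ioo_subset_Icc_self ht)) (fun u hu => ?_) hlt'
    obtain ⟨hu1, hu2, hu3⟩ := hlt (Ioo_subset_Icc_self hu)
    refine mul_pos H.p'_pos ?_
    have hr : 0 ≤ (max (y u) 0) ^ (1 / p) := Real.rpow_nonneg (le_max_right _ _) _
    have hb := H.bdd u (Ioo_subset_Icc_self hu3)
    have : -(|c| + M) ≤ c - h u := by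
      linarith [neg_abs_le c, (abs_le.1 hb).2]
    nlinarith [mul_le_mul_of_nonneg_right this hr]
  have := H.nonneg_of_mem_Ioo hy hy0 hlm
  linarith

theorem nonneg_of_mem_Icc (H : NegReaction p p' s M h f) {c : ℝ} {y : ℝ → ℝ}
    (hy : IsCaraSol p p' h f c 0 s y) (hy0 : y 0 = 0) {t : ℝ} (ht : t ∈ Icc 0 s) : 0 ≤ y t := by
  have hcl := closure_Ioo (a := (0 : ℝ)) (b := s) H.pos.ne
  refine le_on_closure (s := Ioo 0 s) (f := fun _ => (0 : ℝ)) (g := y)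
    (fun u hu => H.nonneg_of_mem_Ioo hy hy0 hu) continuousOn_const ?_ ?_
  · rw [hcl]; exact hy.1
  · rw [hcl]; exact ht

/-- On an interval where `y₁ ≤ y₂`, the difference of the transformed solutions grows at most
at rate `max (c₂ - c₁) 0`. -/
theorem rpow_sub_le_rpow_sub (H : NegReaction p p' s M h f) {c₁ c₂ r t : ℝ} {y₁ y₂ : ℝ → ℝ}
    (h₁ : IsCaraSol p p' h f c₁ 0 s y₁) (h₂ : IsCaraSol p p' h f c₂ 0 s y₂)
    (h₁0 : y₁ 0 = 0) (h₂0 : y₂ 0 = 0) (hr : r ∈ Ioo 0 s) (ht : t ∈ Ioo 0 s) (hrt : r ≤ t)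
    (hle : ∀ u ∈ Icc r t, y₁ u ≤ y₂ u) :
    y₂ t ^ (1 - 1 / p) - y₁ t ^ (1 - 1 / p) ≤
      y₂ r ^ (1 - 1 / p) - y₁ r ^ (1 - 1 / p) + max (c₂ - c₁) 0 * (t - r) := by
  have hsub : ∀ u ∈ Icc r t, u ∈ Ioo 0 s := fun u hu =>
    ⟨hr.1.trans_le hu.1, hu.2.trans_lt ht.2⟩
  have hsub' : Icc r t ⊆ Icc 0 s := fun u hu => Ioo_subset_Icc_self (hsub u hu)
  have key : ∀ {c : ℝ} {y : ℝ → ℝ}, IsCaraSol p p' h f c 0 s y → y 0 = 0 → _ := fun {c y} hy hy0 =>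
    rpow_sub_rpow_eq_integral (q := 1 - 1 / p) hrt
      (H.rhs_integrable (c := c) hy.1 (Ioo_subset_Icc_self hr) (Ioo_subset_Icc_self ht))
      (fun u hu => by
        rw [← H.sub_eq hy (Ioo_subset_Icc_self hr) (hsub' hu)]; ring)
      (fun u hu => H.pos_of_mem_Ioo hy hy0 (hsub u hu))
  have hpt : ∀ (c v u : ℝ), 0 < v → (1 - 1 / p) * v ^ (1 - 1 / p - 1) *
      (p' * ((c - h u) * (max v 0) ^ (1 / p) - f u)) =
      (c - h u) - f u * v ^ (1 - 1 / p - 1) := by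
    intro c v u hv
    have e1 : v ^ (1 - 1 / p - 1) * v ^ (1 / p) = 1 := by
      rw [← Real.rpow_add hv]; simp
    rw [max_eq_left hv.le]
    calc _ = ((1 - 1 / p) * p') * ((c - h u) * (v ^ (1 - 1 / p - 1) * v ^ (1 / p))
            - f u * v ^ (1 - 1 / p - 1)) := by ring
      _ = _ := by rw [e1, H.exponent_mul]; ring
  obtain ⟨i₁, e₁⟩ := key h₁ h₁0
  obtain ⟨i₂, e₂⟩ := key h₂ h₂0
  have hmono := integral_mono_on hrt i₂ (i₁.add (intervalIntegrable_const (c := max (c₂ - c₁) 0)))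
    (fun u hu => by
      have p₁ := H.pos_of_mem_Ioo h₁ h₁0 (hsub u hu)
      have p₂ := H.pos_of_mem_Ioo h₂ h₂0 (hsub u hu)
      have hrp := Real.rpow_le_rpow_of_nonpos p₁ (hle u hu)
        (show 1 - 1 / p - 1 ≤ 0 by have := one_div_pos.2 H.p_pos; linarith)
      have hfu := H.neg u (hsub u hu)
      rw [hpt _ _ _ p₁, hpt _ _ _ p₂]
      nlinarith [le_max_left (c₂ - c₁) 0])
  rw [integral_add i₁ intervalIntegrable_const, ← e₁, ← e₂, intervalIntegral.integral_const, smul_eq_mul] at hmono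
  linarith [mul_comm (t - r) (max (c₂ - c₁) 0)]

theorem rpow_le_rpow_add (H : NegReaction p p' s M h f) {c₁ c₂ t : ℝ} {y₁ y₂ : ℝ → ℝ}
    (h₁ : IsCaraSol p p' h f c₁ 0 s y₁) (h₂ : IsCaraSol p p' h f c₂ 0 s y₂)
    (h₁0 : y₁ 0 = 0) (h₂0 : y₂ 0 = 0) (ht : t ∈ Icc 0 s) :
    y₂ t ^ (1 - 1 / p) ≤ y₁ t ^ (1 - 1 / p) + max (c₂ - c₁) 0 * t := by
  set q := 1 - 1 / p with hq
  set D := max (c₂ - c₁) 0 with hD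
  have hD0 : 0 ≤ D := le_max_right _ _
  have hq0 : 0 < q := H.exponent_pos
  have c₁q : ContinuousOn (fun t => y₁ t ^ q) (Icc 0 s) :=
    h₁.1.rpow_const fun _ _ => Or.inr hq0.le
  have c₂q : ContinuousOn (fun t => y₂ t ^ q) (Icc 0 s) :=
    h₂.1.rpow_const fun _ _ => Or.inr hq0.le
  have hlin : ContinuousOn (fun t => D * t) (Icc 0 s) := by fun_prop
  suffices hmain : ∀ t ∈ Ioo 0 s, y₂ t ^ q ≤ y₁ t ^ q + D * t by
    have hcl := closure_Ioo (a := (0 : ℝ)) (b := s) H.pos.ne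
    refine le_on_closure (s := Ioo 0 s) hmain ?_ ?_ ?_ <;> rw [hcl]
    exacts [c₂q, c₁q.add hlin, ht]
  clear ht
  intro t ht
  by_contra! hlt
  set W : ℝ → ℝ := fun t => y₂ t ^ q - y₁ t ^ q - D * t with hW
  have hWc : ContinuousOn W (Icc 0 s) := (c₂q.sub c₁q).sub hlin
  have hsub : Icc 0 t ⊆ Icc 0 s := Icc_subset_Icc_right ht.2.le
  have hcl : IsClosed (Icc 0 t ∩ W ⁻¹' Iic 0) :=
    (hWc.mono hsub).preimage_isClosed_of_isClosed isClosed_Icc isClosed_Iic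
  have hcpt : IsCompact (Icc 0 t ∩ W ⁻¹' Iic 0) :=
    isCompact_Icc.of_isClosed_subset hcl inter_subset_left
  have hW0 : W 0 ≤ 0 := by simp [hW, h₁0, h₂0]
  obtain ⟨a, ⟨haI, haW⟩, hamax⟩ := hcpt.exists_isGreatest ⟨0, ⟨le_rfl, ht.1.le⟩, hW0⟩
  have haW' : W a ≤ 0 := haW
  have hWt : 0 < W t := by simp only [hW]; linarith
  have hat : a < t := lt_of_le_of_ne haI.2 fun hat => by rw [hat] at haW'; linarith
  have hstep : ∀ r ∈ Ioo a t, W t ≤ W r := by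
    intro r hr
    have := H.rpow_sub_le_rpow_sub h₁ h₂ h₁0 h₂0 (r := r) (t := t)
      ⟨haI.1.trans_lt hr.1, hr.2.trans ht.2⟩ ht hr.2.le (fun u hu => by
        have hau : a < u := hr.1.trans_le hu.1
        have hu0 : 0 ≤ u := haI.1.trans hau.le
        have hWu : 0 < W u := by
          by_contra! hWu
          exact absurd (hamax ⟨⟨hu0, hu.2⟩, hWu⟩) (not_le.2 hau)
        have hus : u ∈ Icc 0 s := hsub ⟨hu0, hu.2⟩
        have hlt : y₁ u ^ q < y₂ u ^ q := by
          simp only [hW] at hWu; nlinarith [mul_nonneg hD0 hu0]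
        exact ((Real.rpow_lt_rpow_iff (H.nonneg_of_mem_Icc h₁ h₁0 hus)
          (H.nonneg_of_mem_Icc h₂ h₂0 hus) hq0).1 hlt).le)
    simp only [hW]
    linarith
  have hcla := closure_Ioo (a := a) (b := t) hat.ne
  have := le_on_closure (s := Ioo a t) (f := fun _ => W t) (g := W) hstep continuousOn_const
    (by rw [hcla]; exact hWc.mono ((Icc_subset_Icc_left haI.1).trans hsub))
    (show a ∈ closure (Ioo a t) by rw [hcla]; exact left_mem_Icc.2 hat.le)
  linarith

theorem le_of_le (H : NegReaction p p' s M h f) {c₁ c₂ t : ℝ} {y₁ y₂ : ℝ → ℝ} (hc : c₁ ≤ c₂)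
    (h₁ : IsCaraSol p p' h f c₁ 0 s y₁) (h₂ : IsCaraSol p p' h f c₂ 0 s y₂)
    (h₁0 : y₁ 0 = 0) (h₂0 : y₂ 0 = 0) (ht : t ∈ Icc 0 s) : y₁ t ≤ y₂ t := by
  have := H.rpow_le_rpow_add h₂ h₁ h₂0 h₁0 ht
  rw [max_eq_right (by linarith), zero_mul, add_zero] at this
  exact (Real.rpow_le_rpow_iff (H.nonneg_of_mem_Icc h₁ h₁0 ht)
    (H.nonneg_of_mem_Icc h₂ h₂0 ht) H.exponent_pos).1 this

theorem lt_of_lt (H : NegReaction p p' s M h f) {c₁ c₂ : ℝ} {y₁ y₂ : ℝ → ℝ} (hc : c₁ < c₂)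
    (h₁ : IsCaraSol p p' h f c₁ 0 s y₁) (h₂ : IsCaraSol p p' h f c₂ 0 s y₂)
    (h₁0 : y₁ 0 = 0) (h₂0 : y₂ 0 = 0) (hpos : 0 < y₁ s) : y₁ s < y₂ s := by
  have hsI : s ∈ Icc 0 s := right_mem_Icc.2 H.pos.le
  refine lt_of_le_of_ne (H.le_of_le hc.le h₁ h₂ h₁0 h₂0 hsI) fun heq => ?_
  have hp0 : 0 < 1 / p := one_div_pos.2 H.p_pos
  set r₁ : ℝ → ℝ := fun u => (max (y₁ u) 0) ^ (1 / p) with hr₁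
  set r₂ : ℝ → ℝ := fun u => (max (y₂ u) 0) ^ (1 / p) with hr₂
  have k₁ : ContinuousOn r₁ (Icc 0 s) :=
    (h₁.1.sup continuousOn_const).rpow_const fun _ _ => Or.inr hp0.le
  have k₂ : ContinuousOn r₂ (Icc 0 s) :=
    (h₂.1.sup continuousOn_const).rpow_const fun _ _ => Or.inr hp0.le
  have hpt : ∀ u ∈ Icc 0 s, 0 < (c₂ - c₁) * r₁ u - (|c₂| + M) * |r₂ u - r₁ u| →
      0 < ((c₂ - h u) * r₂ u - f u) - ((c₁ - h u) * r₁ u - f u) := by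
    intro u hu hlt
    have hb := abs_le.1 (H.bdd u hu)
    have habs : |c₂ - h u| ≤ |c₂| + M := (abs_sub _ _).trans (by linarith [H.bdd u hu])
    have h3 := mul_le_mul_of_nonneg_right habs (abs_nonneg (r₂ u - r₁ u))
    rw [← abs_mul] at h3
    linarith [neg_abs_le ((c₂ - h u) * (r₂ u - r₁ u))]
  have hlim : ContinuousOn (fun u => (c₂ - c₁) * r₁ u - (|c₂| + M) * |r₂ u - r₁ u|) (Icc 0 s) :=
    (continuousOn_const.mul k₁).sub (continuousOn_const.mul (k₂.sub k₁).abs)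
  have hval : 0 < (c₂ - c₁) * r₁ s - (|c₂| + M) * |r₂ s - r₁ s| := by
    have e : r₂ s = r₁ s := by simp only [hr₁, hr₂, heq]
    rw [e, sub_self, abs_zero, mul_zero, sub_zero]
    exact mul_pos (by linarith) (Real.rpow_pos_of_pos (lt_max_of_lt_left hpos) _)
  have ev := (hlim s hsI).tendsto.eventually_const_lt hval
  have ev2 : ∀ᶠ u in 𝓝[≤] s, 0 < (c₂ - c₁) * r₁ u - (|c₂| + M) * |r₂ u - r₁ u| ∧ u ∈ Icc 0 s := by
    have e := nhdsWithin_Icc_eq_nhdsLE H.pos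
    rw [← e]
    exact ev.and self_mem_nhdsWithin
  obtain ⟨l, hl, hls⟩ := mem_nhdsLE_iff_exists_Icc_subset.1 ev2
  have hls' : l < s := hl
  have hlI := (hls (left_mem_Icc.2 hls'.le)).2
  have i₁ := H.rhs_integrable (c := c₁) h₁.1 hlI hsI
  have i₂ := H.rhs_integrable (c := c₂) h₂.1 hlI hsI
  have hpos := intervalIntegral_pos_of_pos_on (i₂.sub i₁) (fun u hu => by
    obtain ⟨hu1, hu2⟩ := hls (Ioo_subset_Icc_self hu)
    have := mul_pos H.p'_pos (hpt u hu2 hu1)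
    rw [mul_sub] at this
    exact this) hls'
  rw [integral_sub i₂ i₁, ← H.sub_eq h₁ hlI hsI, ← H.sub_eq h₂ hlI hsI] at hpos
  have := H.le_of_le hc.le h₁ h₂ h₁0 h₂0 hlI
  linarith

/-- Solutions starting from `0` become arbitrarily small at `s` as the speed tends to `-∞`. -/
theorem exists_forall_lt (H : NegReaction p p' s M h f) {ε : ℝ} (hε : 0 < ε) :
    ∃ c₀ : ℝ, ∀ c ≤ c₀, ∀ y, IsCaraSol p p' h f c 0 s y → y 0 = 0 → y s < ε := by
  have hsI : s ∈ Icc 0 s := right_mem_Icc.2 H.pos.le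
  have h0I : (0 : ℝ) ∈ Icc 0 s := left_mem_Icc.2 H.pos.le
  set g : ℝ → ℝ := fun u => p' * |f u| with hg
  have gi : IntervalIntegrable g volume 0 s := H.integrable.abs.const_mul p'
  have gi' : ∀ {r t : ℝ}, r ∈ Icc 0 s → t ∈ Icc 0 s → IntervalIntegrable g volume r t := by
    intro r t hr ht
    refine gi.mono_set ?_
    rw [uIcc_of_le H.pos.le]
    exact uIcc_subset_Icc hr ht
  have hgnn : ∀ u, 0 ≤ g u := fun u => mul_nonneg H.p'_pos.le (abs_nonneg _)
  -- `r` close to `s` such that little mass of `g` lies in `[r, s]`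
  have hcont : ContinuousOn (fun r => ∫ u in r..s, g u) (Icc 0 s) := by
    have := continuousOn_primitive_interval_left (μ := volume) (f := g) (a := 0) (b := s)
      (by rw [← intervalIntegrable_iff']; exact gi)
    rwa [uIcc_of_le H.pos.le] at this
  have hev : ∀ᶠ r in 𝓝[Icc 0 s] s, ∫ u in r..s, g u < ε / 2 :=
    (hcont s hsI).tendsto.eventually_lt_const (by simp only [integral_same]; linarith)
  have hev2 : ∀ᶠ r in 𝓝[<] s, (∫ u in r..s, g u < ε / 2) ∧ r ∈ Icc 0 s := by
    have e := nhdsWithin_Icc_eq_nhdsLE H.pos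
    rw [e] at hev
    refine ((hev.filter_mono (nhdsWithin_mono s Iio_subset_Iic_self)).and ?_)
    filter_upwards [Ioo_mem_nhdsLT H.pos] with r hr using Ioo_subset_Icc_self hr
  obtain ⟨r, ⟨hr, hrI⟩, hrs⟩ := (hev2.and self_mem_nhdsWithin).exists
  have hrs : r < s := hrs
  set κ : ℝ := p' * (ε / 2) ^ (1 / p) * (s - r) with hκ
  have hκ0 : 0 < κ := mul_pos (mul_pos H.p'_pos (Real.rpow_pos_of_pos (by linarith) _))
    (by linarith)
  refine ⟨-M - (∫ u in (0 : ℝ)..s, g u) / κ, fun c hc y hy hy0 => ?_⟩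
  by_contra! hle
  have hI0 : 0 ≤ ∫ u in (0 : ℝ)..s, g u := integral_nonneg H.pos.le fun u _ => hgnn u
  have hcM : c + M ≤ 0 := by have := div_nonneg hI0 hκ0.le; linarith
  have hpt : ∀ u ∈ Icc 0 s, ∀ m, 0 ≤ m → m ≤ y u →
      p' * ((c - h u) * (max (y u) 0) ^ (1 / p) - f u) ≤
        p' * ((c + M) * m ^ (1 / p)) + g u := by
    intro u hu m hm hmy
    have hb := abs_le.1 (H.bdd u hu)
    have hmm : m ^ (1 / p) ≤ (max (y u) 0) ^ (1 / p) :=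
      Real.rpow_le_rpow hm (hmy.trans (le_max_left _ _)) (one_div_pos.2 H.p_pos).le
    have hm0 : 0 ≤ m ^ (1 / p) := Real.rpow_nonneg hm _
    simp only [hg]
    rw [← mul_add]
    refine mul_le_mul_of_nonneg_left ?_ H.p'_pos.le
    have h1 : (c - h u) * (max (y u) 0) ^ (1 / p) ≤ (c + M) * (max (y u) 0) ^ (1 / p) :=
      mul_le_mul_of_nonneg_right (by linarith) (hm0.trans hmm)
    have h2 := mul_le_mul_of_nonpos_left hmm hcM
    linarith [neg_abs_le (f u)]
  have hinc : ∀ {r t : ℝ}, r ∈ Icc 0 s → t ∈ Icc 0 s → r ≤ t → ∀ m, 0 ≤ m →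
      (∀ u ∈ Icc r t, m ≤ y u) →
      y t - y r ≤ p' * ((c + M) * m ^ (1 / p)) * (t - r) + ∫ u in r..t, g u := by
    intro r t hr ht hrt m hm hmy
    have := integral_mono_on hrt (H.rhs_integrable (c := c) hy.1 hr ht)
      ((intervalIntegrable_const (c := p' * ((c + M) * m ^ (1 / p)))).add (gi' hr ht))
      (fun u hu => hpt u ⟨hr.1.trans hu.1, hu.2.trans ht.2⟩ m hm (hmy u hu))
    rw [integral_add intervalIntegrable_const (gi' hr ht), ← H.sub_eq hy hr ht,
      intervalIntegral.integral_const, smul_eq_mul] at this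
    linarith
  have hp0 : 1 / p ≠ 0 := (one_div_pos.2 H.p_pos).ne'
  have hup : ∀ {r t : ℝ}, r ∈ Icc 0 s → t ∈ Icc 0 s → r ≤ t → y t - y r ≤ ∫ u in r..t, g u := by
    intro r t hr ht hrt
    have := hinc hr ht hrt 0 le_rfl (fun u hu => H.nonneg_of_mem_Icc hy hy0
      ⟨hr.1.trans hu.1, hu.2.trans ht.2⟩)
    simpa [Real.zero_rpow hp0, Real.zero_rpow (inv_ne_zero H.p_pos.ne')] using this
  have hlow : ∀ u ∈ Icc r s, ε / 2 ≤ y u := by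
    intro u hu
    have huI : u ∈ Icc 0 s := ⟨hrI.1.trans hu.1, hu.2⟩
    have h1 := hup huI hsI hu.2
    have h2 : ∫ v in u..s, g v ≤ ∫ v in r..s, g v := by
      rw [← integral_add_adjacent_intervals (gi' hrI huI) (gi' huI hsI)]
      linarith [integral_nonneg (μ := volume) hu.1 fun v _ => hgnn v]
    linarith
  have h1 := hinc hrI hsI hrs.le (ε / 2) (by linarith) hlow
  have h2 := hup h0I hrI hrI.1
  have h3 := integral_add_adjacent_intervals (gi' h0I hrI) (gi' hrI hsI)
  have h4 : (c + M) * κ ≤ -∫ u in (0 : ℝ)..s, g u := by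
    have : c + M ≤ -((∫ u in (0 : ℝ)..s, g u) / κ) := by linarith
    calc (c + M) * κ ≤ -((∫ u in (0 : ℝ)..s, g u) / κ) * κ :=
          mul_le_mul_of_nonneg_right this hκ0.le
      _ = _ := by field_simp
  have h5 : p' * ((c + M) * (ε / 2) ^ (1 / p)) * (s - r) = (c + M) * κ := by rw [hκ]; ring
  linarith

/-- The integral operator with retarded argument, extended by constants outside `[0, s]`. -/
def delayMap (p p' s : ℝ) (h f : ℝ → ℝ) (c δ : ℝ) (y : ℝ → ℝ) (t : ℝ) : ℝ :=
  ∫ u in (0 : ℝ)..max 0 (min t s),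
    p' * ((c - h u) * (max (y (u - δ)) 0) ^ (1 / p) - f u)

/-- Bounded functions on the line whose increments are dominated by those of a primitive of `m`
on `[0, s]`. -/
structure IsDominated (s K : ℝ) (m y : ℝ → ℝ) : Prop where
  cont : Continuous y
  bdd : ∀ t, |y t| ≤ K
  incr : ∀ r t, |y t - y r| ≤ |∫ u in (max 0 (min r s))..(max 0 (min t s)), m u|

theorem clamp_mem (H : NegReaction p p' s M h f) (t : ℝ) : max 0 (min t s) ∈ Icc 0 s :=
  ⟨le_max_left _ _, max_le H.pos.le (min_le_right _ _)⟩

theorem abs_rhs_le (H : NegReaction p p' s M h f) {c K v u : ℝ} (hv : |v| ≤ K)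
    (hu : u ∈ Icc 0 s) :
    |p' * ((c - h u) * (max v 0) ^ (1 / p) - f u)| ≤
      p' * ((|c| + M) * K ^ (1 / p) + |f u|) := by
  have hK : 0 ≤ K := (abs_nonneg _).trans hv
  have h1 : (max v 0) ^ (1 / p) ≤ K ^ (1 / p) :=
    Real.rpow_le_rpow (le_max_right _ _) (max_le ((le_abs_self v).trans hv) hK)
      (one_div_pos.2 H.p_pos).le
  have h0 : 0 ≤ (max v 0) ^ (1 / p) := Real.rpow_nonneg (le_max_right _ _) _
  rw [abs_mul, abs_of_pos H.p'_pos]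
  refine mul_le_mul_of_nonneg_left ((abs_sub _ _).trans (add_le_add ?_ le_rfl)) H.p'_pos.le
  rw [abs_mul, abs_of_nonneg h0]
  refine mul_le_mul ((abs_sub _ _).trans (add_le_add le_rfl (H.bdd u hu))) h1 h0 ?_
  exact add_nonneg (abs_nonneg _) H.M_nonneg

theorem bound_integrable (H : NegReaction p p' s M h f) (c K : ℝ) :
    IntervalIntegrable (fun u => p' * ((|c| + M) * K ^ (1 / p) + |f u|)) volume 0 s :=
  (intervalIntegrable_const.add H.integrable.abs).const_mul p'

theorem isDominated_delayMap (H : NegReaction p p' s M h f) {c δ K : ℝ} {y : ℝ → ℝ}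
    (hK : ∫ u in (0 : ℝ)..s, p' * ((|c| + M) * K ^ (1 / p) + |f u|) ≤ K)
    (hy : IsDominated s K (fun u => p' * ((|c| + M) * K ^ (1 / p) + |f u|)) y) :
    IsDominated s K (fun u => p' * ((|c| + M) * K ^ (1 / p) + |f u|))
      (delayMap p p' s h f c δ y) := by
  set m : ℝ → ℝ := fun u => p' * ((|c| + M) * K ^ (1 / p) + |f u|) with hm
  have hwc : ContinuousOn (fun u => y (u - δ)) (Icc 0 s) :=
    (hy.cont.comp (by fun_prop)).continuousOn
  have hK0 : 0 ≤ K := (abs_nonneg _).trans (hy.bdd 0)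
  have hmnn : ∀ u, 0 ≤ m u := fun u => mul_nonneg H.p'_pos.le (add_nonneg (mul_nonneg
    (add_nonneg (abs_nonneg _) H.M_nonneg) (Real.rpow_nonneg hK0 _)) (abs_nonneg _))
  have mi := H.bound_integrable c K
  have h0I : (0 : ℝ) ∈ Icc 0 s := left_mem_Icc.2 H.pos.le
  have msub : ∀ {r t : ℝ}, r ∈ Icc 0 s → t ∈ Icc 0 s → IntervalIntegrable m volume r t := by
    intro r t hr ht
    refine mi.mono_set ?_
    rw [uIcc_of_le H.pos.le]
    exact uIcc_subset_Icc hr ht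
  have hinc : ∀ r ∈ Icc 0 s, ∀ t ∈ Icc 0 s,
      |∫ u in r..t, p' * ((c - h u) * (max (y (u - δ)) 0) ^ (1 / p) - f u)| ≤
        |∫ u in r..t, m u| := by
    intro r hr t ht
    rw [← Real.norm_eq_abs]
    refine norm_integral_le_abs_of_norm_le ?_ (msub hr ht)
    filter_upwards [ae_restrict_mem measurableSet_uIoc] with u hu
    exact H.abs_rhs_le (hy.bdd _) (uIcc_subset_Icc hr ht (uIoc_subset_uIcc hu))
  refine ⟨?_, fun t => ?_, fun r t => ?_⟩
  · have hprim : ContinuousOn (fun t => ∫ u in (0 : ℝ)..t,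
        p' * ((c - h u) * (max (y (u - δ)) 0) ^ (1 / p) - f u)) (Icc 0 s) := by
      have := continuousOn_primitive_interval' (H.rhs_integrable (c := c) hwc h0I
        (right_mem_Icc.2 H.pos.le)) (left_mem_uIcc)
      rwa [uIcc_of_le H.pos.le] at this
    exact hprim.comp_continuous (by fun_prop) H.clamp_mem
  · refine (hinc 0 h0I _ (H.clamp_mem t)).trans ?_
    rw [abs_of_nonneg (integral_nonneg (H.clamp_mem t).1 fun u _ => hmnn u)]
    refine le_trans ?_ hK
    rw [← integral_add_adjacent_intervals (msub h0I (H.clamp_mem t))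
      (msub (H.clamp_mem t) (right_mem_Icc.2 H.pos.le))]
    linarith [integral_nonneg (μ := volume) (H.clamp_mem t).2 fun u _ => hmnn u]
  · have := hinc _ (H.clamp_mem r) _ (H.clamp_mem t)
    unfold delayMap
    rwa [integral_interval_sub_left (H.rhs_integrable hwc h0I (H.clamp_mem t))
      (H.rhs_integrable hwc h0I (H.clamp_mem r))]

theorem exists_delay_solution (H : NegReaction p p' s M h f) {c δ K : ℝ} (hδ : 0 < δ)
    (hK : ∫ u in (0 : ℝ)..s, p' * ((|c| + M) * K ^ (1 / p) + |f u|) ≤ K) (hK0 : 0 ≤ K) :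
    ∃ y, IsDominated s K (fun u => p' * ((|c| + M) * K ^ (1 / p) + |f u|)) y ∧
      ∀ t ∈ Icc 0 s, y t = ∫ u in (0 : ℝ)..t,
        p' * ((c - h u) * (max (y (u - δ)) 0) ^ (1 / p) - f u) := by
  set T := delayMap p p' s h f c δ with hT
  have hdom : ∀ k : ℕ, IsDominated s K (fun u => p' * ((|c| + M) * K ^ (1 / p) + |f u|))
      (T^[k] fun _ => 0) := by
    intro k
    induction k with
    | zero => exact ⟨continuous_const, by simpa using hK0, fun _ _ => by
      simp only [Function.iterate_zero, id_eq, sub_self, abs_zero]; exact abs_nonneg _⟩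
    | succ k ih => rw [Function.iterate_succ_apply']; exact H.isDominated_delayMap hK ih
  have hstab : ∀ (k : ℕ) (t : ℝ), t ≤ k * δ → (T^[k + 1] fun _ => 0) t = (T^[k] fun _ => 0) t := by
    intro k
    induction k with
    | zero =>
      intro t ht
      have : max 0 (min t s) = 0 := max_eq_left ((min_le_left _ _).trans (by simpa using ht))
      simp only [hT, Function.iterate_succ, Function.iterate_zero, Function.comp_apply, id_eq,
        delayMap, this, integral_same]
    | succ k ih =>
      intro t ht
      have key : T (T^[k + 1] fun _ => 0) t = T (T^[k] fun _ => 0) t := by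
        simp only [hT, delayMap]
        refine integral_congr_ae (Eventually.of_forall fun u hu => ?_)
        rw [uIoc_of_le (H.clamp_mem t).1] at hu
        have hut : u ≤ t := by
          rcases le_max_iff.1 hu.2 with h' | h'
          · exact absurd hu.1 (not_lt.2 h')
          · exact h'.trans (min_le_left _ _)
        have := ih (u - δ) (by push_cast at ht; linarith)
        rw [this]
      rw [Function.iterate_succ_apply' T (k + 1)]
      exact key.trans (congrFun (Function.iterate_succ_apply' T k _) t).symm
  obtain ⟨N, hN⟩ := exists_nat_ge (s / δ)
  refine ⟨_, hdom N, fun t ht => ?_⟩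
  have hst := hstab N t (ht.2.trans ((div_le_iff₀ hδ).1 hN))
  rw [← hst, Function.iterate_succ_apply']
  simp only [hT, delayMap]
  rw [min_eq_left ht.2, max_eq_right ht.1]

theorem exists_bound (H : NegReaction p p' s M h f) (c : ℝ) :
    ∃ K, 0 ≤ K ∧ ∫ u in (0 : ℝ)..s, p' * ((|c| + M) * K ^ (1 / p) + |f u|) ≤ K := by
  set A := p' * ∫ u in (0 : ℝ)..s, |f u|
  set B := p' * (s * (|c| + M))
  obtain ⟨K, hKB, hKA, hK0⟩ := ((((tendsto_rpow_atTop H.exponent_pos).eventually_ge_atTop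
    (2 * B))).and ((eventually_ge_atTop (2 * A)).and (eventually_gt_atTop 0))).exists
  refine ⟨K, hK0.le, ?_⟩
  have hsplit : K ^ (1 - 1 / p) * K ^ (1 / p) = K := by
    rw [← Real.rpow_add hK0, sub_add_cancel, Real.rpow_one]
  have hint : ∫ u in (0 : ℝ)..s, p' * ((|c| + M) * K ^ (1 / p) + |f u|) =
      B * K ^ (1 / p) + A := by
    rw [intervalIntegral.integral_const_mul,
      integral_add intervalIntegrable_const H.integrable.abs, intervalIntegral.integral_const,
      smul_eq_mul]
    ring
  have := mul_le_mul_of_nonneg_right hKB (Real.rpow_nonneg hK0.le (1 / p))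
  rw [hint]
  linarith

theorem exists_solution (H : NegReaction p p' s M h f) (c : ℝ) :
    ∃ y, IsCaraSol p p' h f c 0 s y ∧ y 0 = 0 := by
  obtain ⟨K, hK0, hK⟩ := H.exists_bound c
  have hpos : ∀ n : ℕ, (0 : ℝ) < 1 / ((n : ℝ) + 1) := fun n => by positivity
  choose y hdom hsol using fun n : ℕ => H.exists_delay_solution (hpos n) hK hK0
  set m : ℝ → ℝ := fun u => p' * ((|c| + M) * K ^ (1 / p) + |f u|) with hm
  have mi : IntervalIntegrable m volume 0 s := H.bound_integrable c K
  have h0I : (0 : ℝ) ∈ Icc 0 s := left_mem_Icc.2 H.pos.le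
  have msub : ∀ {r t : ℝ}, r ∈ Icc 0 s → t ∈ Icc 0 s → IntervalIntegrable m volume r t := by
    intro r t hr ht
    refine mi.mono_set ?_
    rw [uIcc_of_le H.pos.le]
    exact uIcc_subset_Icc hr ht
  set G : ℝ → ℝ := fun t => ∫ u in (0 : ℝ)..max 0 (min t s), m u with hG
  have hGc : Continuous G := by
    have := continuousOn_primitive_interval' mi left_mem_uIcc
    rw [uIcc_of_le H.pos.le] at this
    exact this.comp_continuous (by fun_prop) H.clamp_mem
  have hinc : ∀ n r t, |y n t - y n r| ≤ |G t - G r| := by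
    intro n r t
    have := (hdom n).incr r t
    rwa [← integral_interval_sub_left (msub h0I (H.clamp_mem t)) (msub h0I (H.clamp_mem r))]
      at this
  let F : ℕ → BoundedContinuousFunction (Icc (0 : ℝ) s) ℝ := fun n =>
    BoundedContinuousFunction.mkOfCompact ⟨fun x => y n x, (hdom n).cont.comp continuous_subtype_val⟩
  have hcomp : IsCompact (closure (range F)) := by
    refine BoundedContinuousFunction.arzela_ascoli (Icc (-K) K) isCompact_Icc _ ?_ ?_
    · rintro _ x ⟨n, rfl⟩
      exact abs_le.1 ((hdom n).bdd x)
    · intro x₀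
      refine Metric.equicontinuousAt_of_continuity_modulus (α := ℝ) (β := Icc (0 : ℝ) s)
        (fun x : Icc (0 : ℝ) s => |G x - G x₀|) ?_ _ ?_
      · have : Continuous fun x : Icc (0 : ℝ) s => |G x - G x₀| := by fun_prop
        simpa using this.tendsto x₀
      · refine Eventually.of_forall ?_
        rintro x ⟨_, n, rfl⟩
        change dist (y n x₀) (y n x) ≤ |G x - G x₀|
        rw [dist_comm, Real.dist_eq]
        exact hinc n x₀ x
  obtain ⟨Z, -, φ, hφ, hlim⟩ := hcomp.tendsto_subseq fun n => subset_closure (mem_range_self n)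
  set z : ℝ → ℝ := IccExtend H.pos.le Z with hz
  have hzc : Continuous z := Z.continuous.Icc_extend'
  have hpt : ∀ u ∈ Icc 0 s, Tendsto (fun n => y (φ n) u) atTop (𝓝 (z u)) := by
    intro u hu
    have h1 := ((BoundedContinuousFunction.lipschitz_eval_const
      (⟨u, hu⟩ : Icc (0 : ℝ) s)).continuous.tendsto Z).comp hlim
    simp only [hz, IccExtend_of_mem _ _ hu]
    exact h1
  have hδ : Tendsto (fun n => 1 / ((φ n : ℝ) + 1)) atTop (𝓝 0) :=
    tendsto_one_div_add_atTop_nhds_zero_nat.comp hφ.tendsto_atTop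
  have hptd : ∀ u ∈ Icc 0 s, Tendsto (fun n => y (φ n) (u - 1 / ((φ n : ℝ) + 1))) atTop
      (𝓝 (z u)) := by
    intro u hu
    have h1 : Tendsto (fun n => |G (u - 1 / ((φ n : ℝ) + 1)) - G u|) atTop (𝓝 0) := by
      have h2 : Tendsto (fun n => u - 1 / ((φ n : ℝ) + 1)) atTop (𝓝 u) := by
        simpa using hδ.const_sub u
      have h3 := (((hGc.tendsto u).comp h2).sub_const (G u)).abs
      simpa using h3
    have h4 : Tendsto (fun n => y (φ n) (u - 1 / ((φ n : ℝ) + 1)) - y (φ n) u) atTop (𝓝 0) :=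
      squeeze_zero_norm (fun n => hinc (φ n) u _) h1
    simpa using h4.add (hpt u hu)
  have hlimit : ∀ t ∈ Icc 0 s, z t = ∫ u in (0 : ℝ)..t,
      p' * ((c - h u) * (max (z u) 0) ^ (1 / p) - f u) := by
    intro t ht
    refine tendsto_nhds_unique (hpt t ht) ?_
    have hss : uIoc 0 t ⊆ Icc 0 s := uIoc_subset_uIcc.trans (uIcc_subset_Icc h0I ht)
    have : Tendsto (fun n => ∫ u in (0 : ℝ)..t, p' * ((c - h u) *
        (max (y (φ n) (u - 1 / ((φ n : ℝ) + 1))) 0) ^ (1 / p) - f u)) atTop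
        (𝓝 (∫ u in (0 : ℝ)..t, p' * ((c - h u) * (max (z u) 0) ^ (1 / p) - f u))) := by
      refine tendsto_integral_filter_of_dominated_convergence m ?_ ?_ (msub h0I ht) ?_
      · refine Eventually.of_forall fun n => ?_
        exact (intervalIntegrable_iff.1 (H.rhs_integrable (c := c)
          (w := fun u => y (φ n) (u - 1 / ((φ n : ℝ) + 1)))
          ((hdom (φ n)).cont.comp (by fun_prop)).continuousOn h0I ht)).aestronglyMeasurable
      · refine Eventually.of_forall fun n => Eventually.of_forall fun u hu => ?_
        exact H.abs_rhs_le ((hdom (φ n)).bdd _) (hss hu)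
      · refine Eventually.of_forall fun u hu => ?_
        have h1 := ((hptd u (hss hu)).max (tendsto_const_nhds (x := (0 : ℝ)))).rpow_const (p := 1 / p)
          (Or.inr (one_div_pos.2 H.p_pos).le)
        exact ((h1.const_mul (c - h u)).sub_const (f u)).const_mul p'
    refine this.congr fun n => ?_
    exact (hsol (φ n) t ht).symm
  have hz0 : z 0 = 0 := by rw [hlimit 0 h0I, integral_same]
  exact ⟨z, ⟨hzc.continuousOn, fun t ht => by rw [hz0, zero_add]; exact hlimit t ht⟩, hz0⟩

/-- The value at `s` of the solution starting from `0` at `0`, as a function of the speed. -/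
def endpointValue (H : NegReaction p p' s M h f) (c : ℝ) : ℝ :=
  (H.exists_solution c).choose s

theorem eqOn (H : NegReaction p p' s M h f) {c : ℝ} {y₁ y₂ : ℝ → ℝ}
    (h₁ : IsCaraSol p p' h f c 0 s y₁) (h₂ : IsCaraSol p p' h f c 0 s y₂)
    (h₁0 : y₁ 0 = 0) (h₂0 : y₂ 0 = 0) : EqOn y₁ y₂ (Icc 0 s) := fun _ ht =>
  le_antisymm (H.le_of_le le_rfl h₁ h₂ h₁0 h₂0 ht) (H.le_of_le le_rfl h₂ h₁ h₂0 h₁0 ht)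

theorem apply_eq_endpointValue (H : NegReaction p p' s M h f) {c : ℝ} {y : ℝ → ℝ}
    (hy : IsCaraSol p p' h f c 0 s y) (hy0 : y 0 = 0) : y s = H.endpointValue c :=
  H.eqOn hy (H.exists_solution c).choose_spec.1 hy0 (H.exists_solution c).choose_spec.2
    (right_mem_Icc.2 H.pos.le)

theorem exists_solution_endpointValue (H : NegReaction p p' s M h f) (c : ℝ) :
    ∃ y, IsCaraSol p p' h f c 0 s y ∧ y 0 = 0 ∧ y s = H.endpointValue c :=
  ⟨_, (H.exists_solution c).choose_spec.1, (H.exists_solution c).choose_spec.2, rfl⟩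

theorem endpointValue_nonneg (H : NegReaction p p' s M h f) (c : ℝ) : 0 ≤ H.endpointValue c := by
  obtain ⟨y, hy, hy0, hys⟩ := H.exists_solution_endpointValue c
  exact hys ▸ H.nonneg_of_mem_Icc hy hy0 (right_mem_Icc.2 H.pos.le)

theorem monotone_endpointValue (H : NegReaction p p' s M h f) : Monotone H.endpointValue := by
  intro c₁ c₂ hc
  obtain ⟨y₁, h₁, h₁0, h₁s⟩ := H.exists_solution_endpointValue c₁
  obtain ⟨y₂, h₂, h₂0, h₂s⟩ := H.exists_solution_endpointValue c₂
  rw [← h₁s, ← h₂s]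
  exact H.le_of_le hc h₁ h₂ h₁0 h₂0 (right_mem_Icc.2 H.pos.le)

theorem endpointValue_lt (H : NegReaction p p' s M h f) {c₁ c₂ : ℝ} (hc : c₁ < c₂)
    (hpos : 0 < H.endpointValue c₁) : H.endpointValue c₁ < H.endpointValue c₂ := by
  obtain ⟨y₁, h₁, h₁0, h₁s⟩ := H.exists_solution_endpointValue c₁
  obtain ⟨y₂, h₂, h₂0, h₂s⟩ := H.exists_solution_endpointValue c₂
  rw [← h₁s] at hpos
  rw [← h₁s, ← h₂s]
  exact H.lt_of_lt hc h₁ h₂ h₁0 h₂0 hpos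

theorem exists_endpointValue_lt (H : NegReaction p p' s M h f) {ε : ℝ} (hε : 0 < ε) :
    ∃ c₀ : ℝ, ∀ c ≤ c₀, H.endpointValue c < ε := by
  obtain ⟨c₀, hc₀⟩ := H.exists_forall_lt hε
  refine ⟨c₀, fun c hc => ?_⟩
  obtain ⟨y, hy, hy0, hys⟩ := H.exists_solution_endpointValue c
  exact hys ▸ hc₀ c hc y hy hy0

theorem continuous_endpointValue (H : NegReaction p p' s M h f) :
    Continuous H.endpointValue := by
  set q := 1 - 1 / p with hq
  have hle : ∀ c₁ c₂, H.endpointValue c₂ ^ q ≤ H.endpointValue c₁ ^ q + |c₂ - c₁| * s := by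
    intro c₁ c₂
    obtain ⟨y₁, h₁, h₁0, h₁s⟩ := H.exists_solution_endpointValue c₁
    obtain ⟨y₂, h₂, h₂0, h₂s⟩ := H.exists_solution_endpointValue c₂
    rw [← h₁s, ← h₂s]
    refine (H.rpow_le_rpow_add h₁ h₂ h₁0 h₂0 (right_mem_Icc.2 H.pos.le)).trans ?_
    gcongr
    · exact H.pos.le
    · exact max_le (le_abs_self _) (abs_nonneg _)
  have hlip : LipschitzWith (Real.toNNReal s) fun c => H.endpointValue c ^ q := by
    refine LipschitzWith.of_dist_le_mul fun c₁ c₂ => ?_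
    rw [Real.dist_eq, Real.dist_eq, Real.coe_toNNReal _ H.pos.le, abs_le]
    have h₁ := hle c₁ c₂
    have h₂ := hle c₂ c₁
    rw [abs_sub_comm c₂ c₁] at h₁
    constructor <;> linarith
  have hinv : H.endpointValue = fun c => (H.endpointValue c ^ q) ^ q⁻¹ := by
    funext c
    rw [Real.rpow_rpow_inv (H.endpointValue_nonneg c) H.exponent_pos.ne']
  rw [hinv]
  exact hlip.continuous.rpow_const fun _ => Or.inr (inv_nonneg.2 H.exponent_pos.le)

theorem exists_isPosBVPSol_iff (H : NegReaction p p' s M h f) (c : ℝ) :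
    (∃ y, IsPosBVPSol p p' h f c 0 s y) ↔ H.endpointValue c = 0 := by
  constructor
  · rintro ⟨y, hy, hy0, hys, -⟩
    rw [← H.apply_eq_endpointValue hy hy0, hys]
  · intro hV
    obtain ⟨y, hy, hy0, hys⟩ := H.exists_solution_endpointValue c
    exact ⟨y, hy, hy0, hys.trans hV, fun t ht => H.pos_of_mem_Ioo hy hy0 ht⟩

end NegReaction

theorem sSup_zeros_lt_of_monotone {V : ℝ → ℝ} (hV : Continuous V) (hmono : Monotone V) {c : ℝ}
    (hc : 0 < V c) : sSup ((fun c : ℝ => (c : EReal)) '' {c | V c = 0}) < (c : EReal) := by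
  have hev : ∀ᶠ d in 𝓝[<] c, 0 < V d := nhdsWithin_le_nhds (hV.tendsto c (lt_mem_nhds hc))
  obtain ⟨d, hd, hdc⟩ := (hev.and self_mem_nhdsWithin).exists
  refine lt_of_le_of_lt (sSup_le ?_) (EReal.coe_lt_coe_iff.2 hdc)
  rintro _ ⟨e, he, rfl⟩
  refine EReal.coe_le_coe_iff.2 (le_of_not_gt fun hde => ?_)
  exact absurd (hmono hde.le) (not_le.2 (by rwa [show V e = 0 from he]))

theorem lt_sInf_zeros_of_antitone {W : ℝ → ℝ} (hW : Continuous W) (hanti : Antitone W) {c : ℝ}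
    (hc : 0 < W c) : (c : EReal) < sInf ((fun c : ℝ => (c : EReal)) '' {c | W c = 0}) := by
  have hev : ∀ᶠ d in 𝓝[>] c, 0 < W d := nhdsWithin_le_nhds (hW.tendsto c (lt_mem_nhds hc))
  obtain ⟨d, hd, hcd⟩ := (hev.and self_mem_nhdsWithin).exists
  refine lt_of_lt_of_le (EReal.coe_lt_coe_iff.2 hcd) (le_sInf ?_)
  rintro _ ⟨e, he, rfl⟩
  refine EReal.coe_le_coe_iff.2 (le_of_not_gt fun hed => ?_)
  exact absurd (hanti hed.le) (not_le.2 (by rwa [show W e = 0 from he]))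

theorem exists_eq_pos_of_zeros_lt {V W : ℝ → ℝ} (hV : Continuous V) (hW : Continuous W)
    (hmono : Monotone V) (hanti : Antitone W) (hV0 : ∀ c, 0 ≤ V c) (hW0 : ∀ c, 0 ≤ W c)
    (hVlim : ∀ ε > 0, ∃ c₀ : ℝ, ∀ c ≤ c₀, V c < ε) (hWlim : ∀ ε > 0, ∃ c₀ : ℝ, ∀ c ≥ c₀, W c < ε)
    (hlt : sSup ((fun c : ℝ => (c : EReal)) '' {c | V c = 0}) <
      sInf ((fun c : ℝ => (c : EReal)) '' {c | W c = 0})) :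
    ∃ c, V c = W c ∧ 0 < V c := by
  have hVle : ∀ {c : ℝ}, V c = 0 →
      (c : EReal) ≤ sSup ((fun c : ℝ => (c : EReal)) '' {c | V c = 0}) := fun {c} hc =>
    le_sSup ⟨c, hc, rfl⟩
  have hWle : ∀ {c : ℝ}, W c = 0 →
      sInf ((fun c : ℝ => (c : EReal)) '' {c | W c = 0}) ≤ (c : EReal) := fun {c} hc =>
    sInf_le ⟨c, hc, rfl⟩
  obtain ⟨a, ha⟩ : ∃ a, 0 < W a := by
    by_contra! hcon
    refine absurd ?_ hlt.not_ge
    rw [EReal.eq_bot_iff_forall_lt _ |>.2 fun y => (hWle (le_antisymm (hcon (y - 1)) (hW0 _))).trans_lt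
      (EReal.coe_lt_coe_iff.2 (sub_one_lt y))]
    exact bot_le
  obtain ⟨b, hb⟩ : ∃ b, 0 < V b := by
    by_contra! hcon
    refine absurd ?_ hlt.not_ge
    rw [EReal.eq_top_iff_forall_lt _ |>.2 fun y => (EReal.coe_lt_coe_iff.2 (lt_add_one y)).trans_le
      (hVle (le_antisymm (hcon (y + 1)) (hV0 _)))]
    exact le_top
  obtain ⟨a₀, ha₀⟩ := hVlim _ ha
  obtain ⟨b₀, hb₀⟩ := hWlim _ hb
  have hleft : V (min a a₀) ≤ W (min a a₀) :=
    (ha₀ _ (min_le_right _ _)).le.trans (hanti (min_le_left _ _))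
  have hright : W (max b b₀) ≤ V (max b b₀) :=
    (hb₀ _ (le_max_right _ _)).le.trans (hmono (le_max_left _ _))
  obtain ⟨c, hc⟩ : ∃ c, V c = W c := by
    obtain ⟨c, -, hc⟩ := isPreconnected_univ.intermediate_value₂ (mem_univ _) (mem_univ _)
      hV.continuousOn hW.continuousOn hleft hright
    exact ⟨c, hc⟩
  refine ⟨c, hc, lt_of_le_of_ne (hV0 c) fun h0 => ?_⟩
  exact absurd ((hWle (hc ▸ h0.symm)).trans (hVle h0.symm)) hlt.not_ge

/-- Shooting data from both endpoints of `[0, 1]`: the reaction is negative on `(0, s)`, and after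
the reflection `t ↦ 1 - t` it is negative on `(0, 1 - s)` as well. -/
structure BistableReaction (p p' s M : ℝ) (h f : ℝ → ℝ) : Prop where
  mem : s ∈ Ioo (0 : ℝ) 1
  bdd : ∀ t ∈ Icc (0 : ℝ) 1, |h t| ≤ M
  integrable : IntervalIntegrable f volume 0 1
  left : NegReaction p p' s M h f
  right : NegReaction p p' (1 - s) M (fun t => -h (1 - t)) fun t => -f (1 - t)

namespace BistableReaction

variable {p p' s M : ℝ} {h f : ℝ → ℝ}

theorem of_sign_change (hp : 1 < p) (hp' : p' = p / (p - 1)) (hs : s ∈ Ioo (0 : ℝ) 1)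
    (hmeas : Measurable h) (hbd : ∀ t ∈ Icc (0 : ℝ) 1, |h t| ≤ M)
    (hfint : IntegrableOn f (Ioo (0 : ℝ) 1))
    (hfneg : ∀ t ∈ Ioo (0 : ℝ) s, f t < 0) (hfpos : ∀ t ∈ Ioo s (1 : ℝ), 0 < f t)
    (husc : UpperSemicontinuousOn f (Ioo (0 : ℝ) s))
    (hlsc : LowerSemicontinuousOn f (Ioo s (1 : ℝ))) : BistableReaction p p' s M h f := by
  have hfi : IntervalIntegrable f volume 0 1 :=
    (intervalIntegrable_iff_integrableOn_Ioo_of_le zero_le_one).2 hfint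
  have hmaps : MapsTo (fun t : ℝ => 1 - t) (Ioo 0 (1 - s)) (Ioo s 1) := fun t ht =>
    ⟨by linarith [ht.2], by linarith [ht.1]⟩
  refine ⟨hs, hbd, hfi, ⟨hp, hp', hs.1, hmeas, fun t ht => hbd t ⟨ht.1, ht.2.trans hs.2.le⟩,
    hfi.mono_set ?_, hfneg, husc⟩, ⟨hp, hp', sub_pos.2 hs.2, by fun_prop, fun t ht => ?_, ?_,
    fun t ht => neg_neg_of_pos (hfpos _ (hmaps ht)), fun t ht y hy => ?_⟩⟩
  · rw [uIcc_of_le hs.1.le, uIcc_of_le zero_le_one]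
    exact Icc_subset_Icc_right hs.2.le
  · rw [abs_neg]
    exact hbd _ ⟨by linarith [ht.2, hs.1], by linarith [ht.1]⟩
  · have hsub : IntervalIntegrable f volume s 1 := by
      refine hfi.mono_set ?_
      rw [uIcc_of_le hs.2.le, uIcc_of_le zero_le_one]
      exact Icc_subset_Icc_left hs.1.le
    have hrefl : IntervalIntegrable (fun t => f (1 - t)) volume 0 (1 - s) := by
      simpa using (hsub.comp_sub_left 1).symm
    exact hrefl.neg
  · have hev := hlsc (1 - t) (hmaps ht) (-y) (by linarith)
    have htend : Tendsto (fun u : ℝ => 1 - u) (𝓝[Ioo 0 (1 - s)] t) (𝓝[Ioo s 1] (1 - t)) :=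
      (by fun_prop : Continuous fun u : ℝ => 1 - u).continuousWithinAt.tendsto_nhdsWithin hmaps
    filter_upwards [htend.eventually hev] with u hu
    linarith

theorem restrict_left (H : BistableReaction p p' s M h f) {c : ℝ} {y : ℝ → ℝ}
    (hy : IsCaraSol p p' h f c 0 1 y) : IsCaraSol p p' h f c 0 s y :=
  hy.mono H.left.p_pos H.left.meas H.bdd H.integrable le_rfl H.mem.2.le

theorem restrict_right (H : BistableReaction p p' s M h f) {c : ℝ} {y : ℝ → ℝ}
    (hy : IsCaraSol p p' h f c 0 1 y) : IsCaraSol p p' h f c s 1 y :=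
  hy.mono H.left.p_pos H.left.meas H.bdd H.integrable H.mem.1.le le_rfl

theorem integrable_right (H : BistableReaction p p' s M h f) :
    IntervalIntegrable f volume s 1 := by
  refine H.integrable.mono_set ?_
  rw [uIcc_of_le H.mem.2.le, uIcc_of_le zero_le_one]
  exact Icc_subset_Icc_left H.mem.1.le

theorem reflect (H : BistableReaction p p' s M h f) {c : ℝ} {y : ℝ → ℝ}
    (hy : IsCaraSol p p' h f c s 1 y) :
    IsCaraSol p p' (fun t => -h (1 - t)) (fun t => -f (1 - t)) (-c) 0 (1 - s)
      fun t => y (1 - t) := by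
  simpa using hy.reflect H.left.p_pos H.left.meas
    (fun t ht => H.bdd t ⟨H.mem.1.le.trans ht.1, ht.2⟩) H.integrable_right

theorem reflect_symm (H : BistableReaction p p' s M h f) {c : ℝ} {y : ℝ → ℝ}
    (hy : IsCaraSol p p' (fun t => -h (1 - t)) (fun t => -f (1 - t)) (-c) 0 (1 - s) y) :
    IsCaraSol p p' h f c s 1 fun t => y (1 - t) := by
  simpa using hy.reflect H.right.p_pos H.right.meas H.right.bdd H.right.integrable

/-- The value at `s` of the solution vanishing at `1`, as a function of the speed. -/
def backwardValue (H : BistableReaction p p' s M h f) (c : ℝ) : ℝ := H.right.endpointValue (-c)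

theorem apply_eq_backwardValue (H : BistableReaction p p' s M h f) {c : ℝ} {y : ℝ → ℝ}
    (hy : IsCaraSol p p' h f c s 1 y) (hy1 : y 1 = 0) : y s = H.backwardValue c := by
  simpa [backwardValue] using H.right.apply_eq_endpointValue (H.reflect hy) (by simpa using hy1)

theorem exists_isPosBVPSol_right_iff (H : BistableReaction p p' s M h f) (c : ℝ) :
    (∃ y, IsPosBVPSol p p' h f c s 1 y) ↔ H.backwardValue c = 0 := by
  constructor
  · rintro ⟨y, hy, hys, hy1, -⟩
    rw [← H.apply_eq_backwardValue hy hy1, hys]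
  · intro hW
    obtain ⟨y, hy, hy0, hys, hypos⟩ := (H.right.exists_isPosBVPSol_iff (-c)).2 hW
    refine ⟨fun t => y (1 - t), H.reflect_symm hy, hys, by simpa using hy0, fun t ht => ?_⟩
    exact hypos _ ⟨by linarith [ht.2], by linarith [ht.1]⟩

theorem continuous_backwardValue (H : BistableReaction p p' s M h f) :
    Continuous H.backwardValue :=
  H.right.continuous_endpointValue.comp continuous_neg

theorem antitone_backwardValue (H : BistableReaction p p' s M h f) : Antitone H.backwardValue :=
  fun _ _ hc => H.right.monotone_endpointValue (neg_le_neg hc)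

theorem value_eq_and_pos (H : BistableReaction p p' s M h f) {c : ℝ} {y : ℝ → ℝ}
    (hy : IsPosBVPSol p p' h f c 0 1 y) :
    H.left.endpointValue c = H.backwardValue c ∧ 0 < H.left.endpointValue c := by
  obtain ⟨hsol, hy0, hy1, hpos⟩ := hy
  have hl := H.left.apply_eq_endpointValue (H.restrict_left hsol) hy0
  have hr := H.apply_eq_backwardValue (H.restrict_right hsol) hy1
  exact ⟨hl ▸ hr, hl ▸ hpos s H.mem⟩

theorem exists_isPosBVPSol (H : BistableReaction p p' s M h f) {c : ℝ}
    (heq : H.left.endpointValue c = H.backwardValue c) (hpos : 0 < H.left.endpointValue c) :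
    ∃ y, IsPosBVPSol p p' h f c 0 1 y := by
  obtain ⟨y₁, h₁, h₁0, h₁s⟩ := H.left.exists_solution_endpointValue c
  obtain ⟨y₂, h₂, h₂0, h₂s⟩ := H.right.exists_solution_endpointValue (-c)
  set y : ℝ → ℝ := fun t => if t ≤ s then y₁ t else y₂ (1 - t) with hy
  have hys : y₁ s = y₂ (1 - s) := by rw [h₁s, h₂s, heq]; rfl
  have e₁ : EqOn y₁ y (Icc 0 s) := fun t ht => by simp only [hy, if_pos ht.2]
  have e₂ : EqOn (fun t => y₂ (1 - t)) y (Icc s 1) := fun t ht => by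
    rcases ht.1.eq_or_lt with rfl | hlt
    · simp only [hy, le_refl, if_true, hys]
    · simp only [hy, if_neg (not_le.2 hlt)]
  refine ⟨y, ?_, ?_, ?_, fun t ht => ?_⟩
  · exact IsCaraSol.glue H.left.p_pos H.mem.1.le H.mem.2.le H.left.meas H.bdd H.integrable
      (h₁.congr e₁) ((H.reflect_symm h₂).congr e₂)
  · rw [← e₁ ⟨le_rfl, H.mem.1.le⟩, h₁0]
  · rw [← e₂ ⟨H.mem.2.le, le_rfl⟩]; simpa using h₂0
  · rcases lt_trichotomy t s with hts | rfl | hst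
    · rw [← e₁ ⟨ht.1.le, hts.le⟩]
      exact H.left.pos_of_mem_Ioo h₁ h₁0 ⟨ht.1, hts⟩
    · rw [← e₁ ⟨ht.1.le, le_rfl⟩, h₁s]
      exact hpos
    · rw [← e₂ ⟨hst.le, ht.2.le⟩]
      exact H.right.pos_of_mem_Ioo h₂ h₂0 ⟨by linarith [ht.2], by linarith⟩

theorem speed_le (H : BistableReaction p p' s M h f) {c₁ c₂ : ℝ} {y₁ y₂ : ℝ → ℝ}
    (h₁ : IsPosBVPSol p p' h f c₁ 0 1 y₁) (h₂ : IsPosBVPSol p p' h f c₂ 0 1 y₂) : c₂ ≤ c₁ := by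
  by_contra! hlt
  obtain ⟨e₁, pos₁⟩ := H.value_eq_and_pos h₁
  obtain ⟨e₂, -⟩ := H.value_eq_and_pos h₂
  have hl := H.left.endpointValue_lt hlt pos₁
  have hr := H.antitone_backwardValue hlt.le
  linarith

theorem eqOn (H : BistableReaction p p' s M h f) {c : ℝ} {y₁ y₂ : ℝ → ℝ}
    (h₁ : IsPosBVPSol p p' h f c 0 1 y₁) (h₂ : IsPosBVPSol p p' h f c 0 1 y₂) :
    EqOn y₁ y₂ (Icc 0 1) := by
  intro t ht
  rcases le_total t s with hts | hst
  · exact H.left.eqOn (H.restrict_left h₁.1) (H.restrict_left h₂.1) h₁.2.1 h₂.2.1 ⟨ht.1, hts⟩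
  · have := H.right.eqOn (H.reflect (H.restrict_right h₁.1)) (H.reflect (H.restrict_right h₂.1))
      (by simpa using h₁.2.2.1) (by simpa using h₂.2.2.1)
      (x := 1 - t) ⟨by linarith [ht.2], by linarith⟩
    simpa using this

theorem setOf_left (H : BistableReaction p p' s M h f) :
    {c : ℝ | ∃ y, IsPosBVPSol p p' h f c 0 s y} = {c | H.left.endpointValue c = 0} :=
  Set.ext H.left.exists_isPosBVPSol_iff

theorem setOf_right (H : BistableReaction p p' s M h f) :
    {c : ℝ | ∃ y, IsPosBVPSol p p' h f c s 1 y} = {c | H.backwardValue c = 0} :=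
  Set.ext H.exists_isPosBVPSol_right_iff

end BistableReaction

theorem stmt_13
    (p p' s : ℝ) (h f : ℝ → ℝ)
    (hp : 1 < p) (hp'def : p' = p / (p - 1))
    (hs : s ∈ Set.Ioo (0:ℝ) 1)
    (hmeas : Measurable h)
    (hbd : ∃ M : ℝ, ∀ t ∈ Set.Icc (0:ℝ) 1, |h t| ≤ M)
    (hfint : MeasureTheory.IntegrableOn f (Set.Ioo (0:ℝ) 1))
    (hf0 : f 0 = 0) (hfs : f s = 0) (hf1 : f 1 = 0)
    (hfneg : ∀ t ∈ Set.Ioo (0:ℝ) s, f t < 0)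
    (hfpos : ∀ t ∈ Set.Ioo s (1:ℝ), 0 < f t)
    (husc : UpperSemicontinuousOn f (Set.Ioo (0:ℝ) s))
    (hlsc : LowerSemicontinuousOn f (Set.Ioo s (1:ℝ)))
    (hhc : ContinuousAt h s)
    (hhfin : ∃ S : Finset ℝ, ContinuousOn h (Set.Icc (0:ℝ) 1 \ ↑S))
    (hint : 0 ≤ ∫ t in (0:ℝ)..1, f t) :
    ((∃ c : ℝ, ∃ y, IsPosBVPSol p p' h f c 0 1 y) ↔
      sSup ((fun c : ℝ => (c : EReal)) '' {c : ℝ | ∃ y, IsPosBVPSol p p' h f c 0 s y}) <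
        sInf ((fun c : ℝ => (c : EReal)) '' {c : ℝ | ∃ y, IsPosBVPSol p p' h f c s 1 y})) ∧
    (∀ c : ℝ, ∀ y, IsPosBVPSol p p' h f c 0 1 y →
      sSup ((fun c : ℝ => (c : EReal)) '' {c : ℝ | ∃ y, IsPosBVPSol p p' h f c 0 s y}) < (c : EReal) ∧
      (c : EReal) < sInf ((fun c : ℝ => (c : EReal)) '' {c : ℝ | ∃ y, IsPosBVPSol p p' h f c s 1 y})) ∧
    (∀ c₁ c₂ : ℝ, ∀ y₁ y₂, IsPosBVPSol p p' h f c₁ 0 1 y₁ → IsPosBVPSol p p' h f c₂ 0 1 y₂ →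
      c₁ = c₂ ∧ Set.EqOn y₁ y₂ (Set.Icc 0 1)) := by
  obtain ⟨M, hM⟩ := hbd
  have H : BistableReaction p p' s M h f :=
    .of_sign_change hp hp'def hs hmeas hM hfint hfneg hfpos husc hlsc
  have hbetween : ∀ c : ℝ, ∀ y, IsPosBVPSol p p' h f c 0 1 y →
      sSup ((fun c : ℝ => (c : EReal)) '' {c : ℝ | ∃ y, IsPosBVPSol p p' h f c 0 s y}) <
        (c : EReal) ∧
      (c : EReal) <
        sInf ((fun c : ℝ => (c : EReal)) '' {c : ℝ | ∃ y, IsPosBVPSol p p' h f c s 1 y}) := by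
    intro c y hy
    obtain ⟨heq, hpos⟩ := H.value_eq_and_pos hy
    rw [H.setOf_left, H.setOf_right]
    exact ⟨sSup_zeros_lt_of_monotone H.left.continuous_endpointValue H.left.monotone_endpointValue
      hpos, lt_sInf_zeros_of_antitone H.continuous_backwardValue H.antitone_backwardValue
      (heq ▸ hpos)⟩
  refine ⟨⟨?_, ?_⟩, hbetween, ?_⟩
  · rintro ⟨c, y, hy⟩
    exact (hbetween c y hy).1.trans (hbetween c y hy).2
  · intro hlt
    rw [H.setOf_left, H.setOf_right] at hlt
    have hWlim : ∀ ε > 0, ∃ c₀ : ℝ, ∀ c ≥ c₀, H.backwardValue c < ε := fun ε hε => by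
      obtain ⟨c₀, hc₀⟩ := H.right.exists_endpointValue_lt hε
      exact ⟨-c₀, fun c hc => hc₀ (-c) (by linarith)⟩
    obtain ⟨c, heq, hpos⟩ := exists_eq_pos_of_zeros_lt H.left.continuous_endpointValue
      H.continuous_backwardValue H.left.monotone_endpointValue H.antitone_backwardValue
      H.left.endpointValue_nonneg (fun c => H.right.endpointValue_nonneg (-c))
      (fun ε hε => H.left.exists_endpointValue_lt hε) hWlim hlt
    exact ⟨c, H.exists_isPosBVPSol heq hpos⟩
  · intro c₁ c₂ y₁ y₂ h₁ h₂
    obtain rfl : c₁ = c₂ := le_antisymm (H.speed_le h₂ h₁) (H.speed_le h₁ h₂)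
    exact ⟨rfl, H.eqOn h₁ h₂⟩
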